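/- For all positive integers r, d, n with 1 ≤ r ≤ n/2, there exists a non-adaptive (r,d,n)-locally decodable source code c whose expected codeword length satisfies E[ℓ(c(X^n))] ≤ 30 (rd+1) · ( (r+1)^{r+1} · C(n,r) )^{1/(rd+1)}, where C(n,r) denotes the binomial coefficient n choose r. -/

import Mathlib

open Filter MeasureTheory

/-- A binary decision tree: internal nodes probe a (1-indexed) position of the
codeword, leaves output a bit. -/
inductive DTree : Type
  | leaf (b : Bool) : DTree
  | node (pos : ℕ) (lo hi : DTree) : DTree

namespace DTree

/-- Depth of a decision tree. -/
def depth : DTree → ℕ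
  | leaf _ => 0
  | node _ l h => 1 + max l.depth h.depth

/-- All probed positions lie in `{1, …, ℓ}`. -/
def boundedBy (ℓ : ℕ) : DTree → Prop
  | leaf _ => True
  | node p l h => 1 ≤ p ∧ p ≤ ℓ ∧ l.boundedBy ℓ ∧ h.boundedBy ℓ

/-- Evaluate the tree on a codeword `w` (positions are 1-indexed). -/
def eval (w : List Bool) : DTree → Bool
  | leaf b => b
  | node p l h => if w.getD (p - 1) false then h.eval w else l.eval w

end DTree

/-- `x : Fin n → Bool` has exactly `r` ones. -/
def Sparse (n r : ℕ) (x : Fin n → Bool) : Prop :=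
  (Finset.univ.filter fun i => x i = true).card = r

instance (n r : ℕ) : DecidablePred (Sparse n r) := fun _ => Nat.decEq _ r

/-- The type of `r`-sparse binary vectors of length `n`. -/
abbrev SparseVec (n r : ℕ) := {x : Fin n → Bool // Sparse n r x}

/-- A non-adaptive `(r,d,n)`-locally decodable source code. -/
structure NonAdaptiveLDC (r d n : ℕ) where
  enc : SparseVec n r → List Bool
  enc_inj : Function.Injective enc
  S : Fin n → ℕ → Finset ℕ
  S_sub : ∀ j ℓ, S j ℓ ⊆ Finset.Icc 1 ℓ
  S_card : ∀ j ℓ, (S j ℓ).card ≤ d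
  g : Fin n → ℕ → (ℕ → Bool) → Bool
  g_local : ∀ j ℓ f f', (∀ i ∈ S j ℓ, f i = f' i) → g j ℓ f = g j ℓ f'
  correct : ∀ x (j : Fin n),
    g j (enc x).length (fun i => (enc x).getD (i - 1) false) = x.1 j

/-- Expected codeword length under the uniform distribution on `r`-sparse vectors. -/
noncomputable def expLenN {r d n : ℕ} (c : NonAdaptiveLDC r d n) : ℝ :=
  (∑ x : SparseVec n r, ((c.enc x).length : ℝ)) / (n.choose r : ℝ)

/-- Success of a hashing scheme `σ` on `x`. -/
def Succ {n d b K : ℕ} (σ : Fin n → (Fin d → Fin b) ⊕ Fin K) (x : Fin n → Bool) : Prop :=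
  ∀ j, x j = true ↔ ∃ p, σ j = Sum.inl p ∧
    ∀ i, ∃ a q, x a = true ∧ σ a = Sum.inl q ∧ q i = p i

open Classical in
theorem count_succ {n d b K r : ℕ} (x : SparseVec n r) :
    (b ^ d) ^ r * (b ^ d + K - r ^ d) ^ (n - r) ≤
      (Finset.univ.filter
        (fun σ : Fin n → (Fin d → Fin b) ⊕ Fin K => Succ σ x.1)).card := by
  have hx : Fintype.card {j // x.1 j = true} = r := by
    rw [Fintype.card_subtype]; exact x.2
  have hx' : Fintype.card {j // ¬ x.1 j = true} = n - r := by
    rw [Fintype.card_subtype_compl, hx, Fintype.card_fin]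
  let bad : ({j // x.1 j = true} → (Fin d → Fin b)) → Finset ((Fin d → Fin b) ⊕ Fin K) :=
    fun u => (Fintype.piFinset
      (fun i => Finset.univ.image (fun a => u a i))).map ⟨Sum.inl, Sum.inl_injective⟩
  have hbad : ∀ u, (bad u).card ≤ r ^ d := by
    intro u
    simp only [bad, Finset.card_map, Fintype.card_piFinset]
    calc _ ≤ ∏ _i : Fin d, r := by
          apply Finset.prod_le_prod' 
          intro i _
          exact Finset.card_image_le.trans (by rw [Finset.card_univ, hx])
      _ = r ^ d := by simp
  have hmem : ∀ u p, Sum.inl p ∈ bad u ↔ ∀ i, ∃ a, u a i = p i := by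
    intro u p
    simp [bad, Fintype.mem_piFinset]
  let G := (Finset.univ : Finset ({j // x.1 j = true} → (Fin d → Fin b))).sigma
    (fun u => Fintype.piFinset (fun _ : {j // ¬ x.1 j = true} => (bad u)ᶜ))
  have hG : (b ^ d) ^ r * (b ^ d + K - r ^ d) ^ (n - r) ≤ G.card := by
    simp only [G, Finset.card_sigma, Fintype.card_piFinset, Finset.prod_const, Finset.card_univ,
      hx', Finset.card_compl]
    calc _ = ∑ _u : {j // x.1 j = true} → (Fin d → Fin b), 
            (b ^ d + K - r ^ d) ^ (n - r) := by
          rw [Finset.sum_const, Finset.card_univ, Fintype.card_fun, hx, Fintype.card_fun]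
          simp
      _ ≤ _ := by
          apply Finset.sum_le_sum
          intro u _
          apply Nat.pow_le_pow_left
          have := hbad u
          simp only [Fintype.card_sum, Fintype.card_fun, Fintype.card_fin]
          omega
  refine hG.trans ?_
  apply Finset.card_le_card_of_injOn
    (fun s j => if h : x.1 j = true then Sum.inl (s.1 ⟨j, h⟩) else s.2 ⟨j, h⟩)
  · rintro ⟨u, v⟩ huv
    simp only [G, Finset.coe_sigma, Set.mem_sigma_iff, Finset.coe_univ, Set.mem_univ, true_and,
      Finset.mem_coe, Fintype.mem_piFinset, Finset.mem_compl] at huv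
    simp only [Finset.coe_filter, Finset.mem_univ, true_and, Set.mem_ofPred_eq]
    intro j
    by_cases hj : x.1 j = true
    · simp only [hj, dite_true, true_iff]
      exact ⟨_, rfl, fun i => ⟨j, _, hj, by rw [dif_pos hj], rfl⟩⟩
    · refine iff_of_false hj ?_
      rintro ⟨p, hp, hq⟩
      dsimp only at hp hq
      rw [dif_neg hj] at hp
      apply huv ⟨j, hj⟩
      rw [hp, hmem]
      intro i
      obtain ⟨a, q, ha, hσ, hqi⟩ := hq i
      rw [dif_pos ha] at hσ
      refine ⟨⟨a, ha⟩, ?_⟩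
      rw [← hqi, ← Sum.inl_injective hσ]
  · rintro ⟨u, v⟩ _ ⟨u', v'⟩ _ h
    have h1 : u = u' := by
      funext ⟨j, hj⟩
      have := congrFun h j
      simp only [hj, dite_true] at this
      exact Sum.inl_injective this
    have h2 : v = v' := by
      funext ⟨j, hj⟩
      have := congrFun h j
      dsimp only at this
      rwa [dif_neg hj, dif_neg hj] at this
    rw [h1, h2]

open Classical in
theorem greedy {Ω X : Type} [Fintype Ω] [Nonempty Ω] (succ : Ω → X → Prop) (q : ℝ)
    (hq : 0 < q) (h : ∀ x, q * (Fintype.card Ω : ℝ) ≤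
      ((Finset.univ.filter (fun σ => succ σ x)).card : ℝ)) (m : ℕ) :
    ∀ R : Finset X, R.card ≤ m → ∃ (σ : ℕ → Ω) (k : X → ℕ), (∀ x ∈ R, succ (σ (k x)) x) ∧
      (∑ x ∈ R, (k x : ℝ)) ≤ R.card / q := by
  induction m with
  | zero =>
    intro R hR
    have : R = ∅ := by simpa using hR
    subst this
    exact ⟨fun _ => Classical.arbitrary _, fun _ => 0, by simp, by simp⟩
  | succ m ih =>
    intro R hR
    rcases R.eq_empty_or_nonempty with rfl | hne
    · exact ⟨fun _ => Classical.arbitrary _, fun _ => 0, by simp, by simp⟩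
    have hRpos : (0 : ℝ) < R.card := by exact_mod_cast hne.card_pos
    obtain ⟨s, hs⟩ : ∃ s : Ω, q * R.card ≤ ((R.filter (fun x => succ s x)).card : ℝ) := by
      by_contra! hcon
      have h1 : ∑ s : Ω, ((R.filter (fun x => succ s x)).card : ℝ) < ∑ _s : Ω, q * R.card :=
        Finset.sum_lt_sum_of_nonempty Finset.univ_nonempty (fun s _ => hcon s)
      have h2 : ∑ s : Ω, ((R.filter (fun x => succ s x)).card : ℝ) =
          ∑ x ∈ R, ((Finset.univ.filter (fun σ => succ σ x)).card : ℝ) := by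
        simp only [Finset.card_filter, Nat.cast_sum]
        exact Finset.sum_comm
      have h3 : ∑ _x ∈ R, q * (Fintype.card Ω : ℝ) ≤ 
          ∑ x ∈ R, ((Finset.univ.filter (fun σ => succ σ x)).card : ℝ) :=
        Finset.sum_le_sum (fun x _ => h x)
      simp only [Finset.sum_const, nsmul_eq_mul, Finset.card_univ] at h1 h3
      rw [h2] at h1
      nlinarith
    have hsplit := Finset.card_filter_add_card_filter_not (s := R) (fun x => succ s x)
    have hsplit' : ((R.filter (fun x => succ s x)).card : ℝ) +
      ((R.filter (fun x => ¬ succ s x)).card : ℝ) = R.card := by exact_mod_cast hsplit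
    have hpos : (0 : ℝ) < ((R.filter (fun x => succ s x)).card : ℝ) :=
      lt_of_lt_of_le (by positivity) hs
    have hpos' : 0 < (R.filter (fun x => succ s x)).card := by exact_mod_cast hpos
    obtain ⟨σ, k, h1, h2⟩ := ih (R.filter (fun x => ¬ succ s x)) (by omega)
    refine ⟨fun i => Nat.casesOn i s σ, fun x => if succ s x then 0 else k x + 1, ?_, ?_⟩
    · intro x hx
      by_cases hsx : succ s x
      · simpa [hsx] using hsx
      · simpa [hsx] using h1 x (by simp [hx, hsx])
    · have e : (∑ x ∈ R, ((if succ s x then 0 else k x + 1 : ℕ) : ℝ)) =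
          ∑ x ∈ R.filter (fun x => ¬ succ s x), ((k x : ℝ) + 1) := by
        rw [Finset.sum_filter]
        apply Finset.sum_congr rfl
        intro x _
        by_cases hsx : succ s x <;> simp [hsx]
      rw [e, Finset.sum_add_distrib]
      simp only [Finset.sum_const, nsmul_eq_mul, mul_one]
      rw [le_div_iff₀ hq] at h2 ⊢
      nlinarith

open Classical in
theorem code_exists {r d n b K : ℕ} (σ : ℕ → Fin n → (Fin d → Fin b) ⊕ Fin K)
    (k : SparseVec n r → ℕ) (hk : ∀ x, Succ (σ (k x)) x.1) :
    ∃ c : NonAdaptiveLDC r d n, ∀ x, (c.enc x).length = d * b + k x := by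
  let enc : SparseVec n r → List Bool := fun x =>
    List.ofFn (n := d * b + k x) (fun t => decide (∃ a q i, x.1 a = true ∧
      σ (k x) a = Sum.inl q ∧ (finProdFinEquiv (i, q i)).val = t.val))
  have hlen : ∀ x, (enc x).length = d * b + k x := fun x => by simp [enc]
  let S : Fin n → ℕ → Finset ℕ := fun j ℓ =>
    if d * b ≤ ℓ then
      match σ (ℓ - d * b) j with
      | Sum.inl p => Finset.univ.image (fun i => (finProdFinEquiv (i, p i)).val + 1)
      | Sum.inr _ => ∅
    else ∅
  let g : Fin n → ℕ → (ℕ → Bool) → Bool := fun j ℓ f =>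
    decide ((∃ p, σ (ℓ - d * b) j = Sum.inl p) ∧ ∀ i ∈ S j ℓ, f i = true)
  have correct : ∀ x (j : Fin n),
      g j (enc x).length (fun i => (enc x).getD (i - 1) false) = x.1 j := by
    intro x j
    have h := hk x j
    rw [Bool.eq_iff_iff, h]
    simp only [g, hlen, decide_eq_true_eq, Nat.add_sub_cancel_left, S, Nat.le_add_right, if_true]
    have key : ∀ p : Fin d → Fin b, ∀ i, (enc x).getD (finProdFinEquiv (i, p i)).val false = true ↔
        ∃ a q, x.1 a = true ∧ σ (k x) a = Sum.inl q ∧ q i = p i := by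
      intro p i
      have hlt : (finProdFinEquiv (i, p i)).val < (enc x).length := by
        rw [hlen]; exact lt_of_lt_of_le (finProdFinEquiv (i, p i)).isLt (Nat.le_add_right _ _)
      rw [List.getD_eq_getElem _ _ hlt]
      simp only [enc, List.getElem_ofFn, decide_eq_true_eq]
      constructor
      · rintro ⟨a, q, i', ha, hq, he⟩
        have := finProdFinEquiv.injective (Fin.ext he)
        rw [Prod.mk.injEq] at this
        obtain ⟨rfl, h2⟩ := this
        exact ⟨a, q, ha, hq, h2⟩
      · rintro ⟨a, q, ha, hq, he⟩
        exact ⟨a, q, i, ha, hq, by rw [he]⟩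
    cases hσ : σ (k x) j with
    | inr v => simp
    | inl p =>
      simp only [Finset.mem_image, Finset.mem_univ, true_and, forall_exists_index,
        forall_apply_eq_imp_iff, Nat.add_sub_cancel, key, Sum.inl.injEq, exists_eq', 
        exists_eq_left']
  refine ⟨⟨enc, ?_, S, ?_, ?_, g, ?_, correct⟩, hlen⟩
  · intro x y hxy
    apply Subtype.ext
    funext j
    rw [← correct x j, ← correct y j, hxy]
  · intro j ℓ t ht
    simp only [S] at ht
    split_ifs at ht with hl
    · cases hσ : σ (ℓ - d * b) j with
      | inr v => simp [hσ] at ht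
      | inl p =>
        simp only [hσ, Finset.mem_image, Finset.mem_univ, true_and] at ht
        obtain ⟨i, rfl⟩ := ht
        have := (finProdFinEquiv (i, p i)).isLt
        rw [Finset.mem_Icc]; omega
    · simp at ht
  · intro j ℓ
    simp only [S]
    split_ifs with hl
    · cases hσ : σ (ℓ - d * b) j with
      | inr v => simp
      | inl p => exact Finset.card_image_le.trans (by simp)
    · simp
  · intro j ℓ f f' hff
    simp only [g]
    congr 1
    apply propext
    apply and_congr_right
    intro _
    apply forall₂_congr
    intro i hi
    rw [hff i hi]

theorem card_sparse (n r : ℕ) : Fintype.card (SparseVec n r) = n.choose r := by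
  have : Fintype.card {s : Finset (Fin n) // s.card = r} = n.choose r := by
    simp
  rw [← this]
  apply Fintype.card_congr
  refine ⟨fun x => ⟨Finset.univ.filter fun i => x.1 i = true, x.2⟩,
    fun s => ⟨fun i => decide (i ∈ s.1), by simp [Sparse, s.2]⟩, ?_, ?_⟩
  · intro x; ext; simp
  · intro s; ext; simp

theorem third_le (N m : ℕ) (hN : 2 ≤ N) (hm : m + 1 ≤ N) :
    (1 / 3 : ℝ) * (N : ℝ) ^ m ≤ ((N : ℝ) - 1) ^ m := by
  obtain ⟨M, rfl⟩ : ∃ M, N = M + 1 := ⟨N - 1, by omega⟩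
  have hM : (0 : ℝ) < M := by exact_mod_cast (by omega : 0 < M)
  have h1 : ((M : ℝ) + 1) ^ m ≤ 3 * (M : ℝ) ^ m := by
    have e : (M : ℝ) + 1 = (1 / M + 1) * M := by field_simp; ring
    rw [e, mul_pow]
    apply mul_le_mul_of_nonneg_right _ (by positivity)
    calc ((1 : ℝ) / M + 1) ^ m ≤ (Real.exp (1 / M)) ^ m :=
          pow_le_pow_left₀ (by positivity) (Real.add_one_le_exp _) _
      _ = Real.exp (m * (1 / M)) := by rw [← Real.exp_nat_mul]
      _ ≤ Real.exp 1 := by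
          apply Real.exp_le_exp.mpr
          rw [mul_one_div, div_le_one hM]
          exact_mod_cast (by omega : m ≤ M)
      _ ≤ 3 := Real.exp_one_lt_three.le
  push_cast
  simp only [add_sub_cancel_right]
  linarith

theorem pow_le_choose_nat (r : ℕ) : ∀ n, r ≤ n → n ^ r ≤ r ^ r * n.choose r := by
  induction r with
  | zero => intro n _; simp
  | succ r ih =>
    intro n hn
    obtain ⟨n, rfl⟩ : ∃ m, n = m + 1 := ⟨n - 1, by omega⟩
    have h1 := ih n (by omega)
    have h2 : ((n + 1) * r) ^ r ≤ (n * (r + 1)) ^ r :=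
      Nat.pow_le_pow_left (by nlinarith) r
    have hr : 0 < r ^ r := by
      rcases Nat.eq_zero_or_pos r with rfl | h
      · simp
      · positivity
    have h3 : (n + 1) ^ r ≤ (r + 1) ^ r * n.choose r := by
      apply Nat.le_of_mul_le_mul_right _ hr
      calc (n + 1) ^ r * r ^ r = ((n + 1) * r) ^ r := by rw [mul_pow]
        _ ≤ (n * (r + 1)) ^ r := h2
        _ = n ^ r * (r + 1) ^ r := by rw [mul_pow]
        _ ≤ r ^ r * n.choose r * (r + 1) ^ r := Nat.mul_le_mul_right _ h1
        _ = _ := by ring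
    have h4 := Nat.add_one_mul_choose_eq n r
    calc (n + 1) ^ (r + 1) = (n + 1) ^ r * (n + 1) := pow_succ _ _
      _ ≤ (r + 1) ^ r * n.choose r * (n + 1) := Nat.mul_le_mul_right _ h3
      _ = (r + 1) ^ r * ((n + 1) * n.choose r) := by ring
      _ = _ := by rw [h4]; ring

theorem pow_le_choose' (n r : ℕ) (hr : 1 ≤ r) (hrn : r ≤ n) :
    (n : ℝ) ^ r ≤ ((r : ℝ) + 1) ^ (r + 1) * (n.choose r : ℝ) := by
  have h : (n : ℝ) ^ r ≤ (r : ℝ) ^ r * n.choose r := by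
    exact_mod_cast pow_le_choose_nat r n hrn
  refine h.trans (mul_le_mul_of_nonneg_right ?_ (by positivity))
  have h0 : (0 : ℝ) ≤ r := by positivity
  calc (r : ℝ) ^ r ≤ ((r : ℝ) + 1) ^ r := pow_le_pow_left₀ h0 (by linarith) _
    _ ≤ ((r : ℝ) + 1) ^ (r + 1) := pow_le_pow_right₀ (by linarith) (by omega)

theorem bound_t (r d n t : ℕ) (hr : 1 ≤ r) (ht : 1 ≤ t) (hrn : 2 * r ≤ n) :
    ∃ c : NonAdaptiveLDC r d n,
      expLenN c ≤ d * (r * t) + 3 * max (1 : ℝ) ((n : ℝ) ^ r / ((t : ℝ) ^ d) ^ r) := by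
  classical
  set N := max n (t ^ d) with hN
  have hNn : n ≤ N := le_max_left _ _
  have hNt : t ^ d ≤ N := le_max_right _ _
  set K := r ^ d * (N - t ^ d) with hK
  have hrd : 1 ≤ r ^ d := Nat.one_le_pow _ _ hr
  have htd : 1 ≤ t ^ d := Nat.one_le_pow _ _ ht
  have hKe : (r * t) ^ d + K = r ^ d * N := by
    rw [hK, mul_pow, ← mul_add, Nat.add_sub_cancel' hNt]
  have hKs : (r * t) ^ d + K - r ^ d = r ^ d * (N - 1) := by
    rw [hKe, Nat.mul_sub, mul_one]
  let Ω := Fin n → (Fin d → Fin (r * t)) ⊕ Fin K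
  have hΩ : Fintype.card Ω = (r ^ d * N) ^ n := by
    simp [Ω, hKe]
  haveI : Nonempty Ω := by
    rw [← Fintype.card_pos_iff, hΩ]
    have : 0 < N := by omega
    positivity
  have hN0 : (0 : ℝ) < N := by exact_mod_cast (by omega : 0 < N)
  have hr0 : (0 : ℝ) < r := by exact_mod_cast hr
  have ht0 : (0 : ℝ) < t := by exact_mod_cast ht
  set q : ℝ := (1 / 3) * ((t : ℝ) ^ d / N) ^ r with hq
  have hq0 : 0 < q := by positivity
  have hcount : ∀ x : SparseVec n r, q * (Fintype.card Ω : ℝ) ≤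
      ((Finset.univ.filter (fun σ : Ω => Succ σ x.1)).card : ℝ) := by
    intro x
    have h := count_succ (d := d) (b := r * t) (K := K) x
    rw [hKs] at h
    refine le_trans ?_ (Nat.cast_le.mpr h)
    rw [hΩ, hq]
    push_cast [Nat.cast_sub (show 1 ≤ N by omega)]
    have h3 := third_le N (n - r) (by omega) (by omega)
    have en : (n : ℕ) = r + (n - r) := by omega
    have e1 : 1 / 3 * ((t : ℝ) ^ d / N) ^ r * (((r : ℝ) ^ d * N) ^ n) =
        (((r : ℝ) * t) ^ d) ^ r * (((r : ℝ) ^ d) ^ (n - r) * (1 / 3 * (N : ℝ) ^ (n - r))) := by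
      conv_lhs => rw [en, pow_add]
      rw [div_pow, mul_pow (r : ℝ) t d, mul_pow _ _ r, mul_pow _ _ r, mul_pow _ _ (n - r)]
      field_simp
    rw [e1, mul_pow ((r : ℝ) ^ d) _ (n - r)]
    gcongr
  obtain ⟨σ, k, h1, h2⟩ := greedy (fun (s : Ω) (x : SparseVec n r) => Succ s x.1) q hq0 hcount
    _ Finset.univ le_rfl
  obtain ⟨c, hc⟩ := code_exists σ k (fun x => h1 x (Finset.mem_univ _))
  refine ⟨c, ?_⟩
  have hch : (0 : ℝ) < n.choose r := by exact_mod_cast Nat.choose_pos (by omega)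
  rw [Finset.card_univ, card_sparse] at h2
  have hq1 : 1 / q ≤ 3 * max (1 : ℝ) ((n : ℝ) ^ r / ((t : ℝ) ^ d) ^ r) := by
    have : 1 / q = 3 * ((N : ℝ) ^ r / ((t : ℝ) ^ d) ^ r) := by
      rw [hq, div_pow]; field_simp
    rw [this]
    apply mul_le_mul_of_nonneg_left _ (by norm_num)
    rcases le_total n (t ^ d) with hle | hle
    · apply le_max_of_le_left
      have : N = t ^ d := max_eq_right hle
      rw [this]; push_cast
      rw [div_self (by positivity)]
    · apply le_max_of_le_right
      have : N = n := max_eq_left hle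
      rw [this]
  refine le_trans ?_ (add_le_add_right hq1 _)
  rw [expLenN, div_le_iff₀ hch]
  simp only [hc, Nat.cast_add, Finset.sum_add_distrib, Finset.sum_const, Finset.card_univ,
    card_sparse, nsmul_eq_mul]
  push_cast
  have : (n.choose r : ℝ) / q = 1 / q * n.choose r := by ring
  rw [this] at h2
  linarith

/-- Theorem 2 (achievability): there exists a non-adaptive `(r,d,n)`-locally decodable
source code with
`E[ℓ(c(Xⁿ))] ≤ 30 (rd+1) ((r+1)^{r+1} C(n,r))^{1/(rd+1)}`. -/
theorem nonadaptive_upper_bound (r d n : ℕ) (hr : 1 ≤ r) (hd : 1 ≤ d) (hrn : 2 * r ≤ n) :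
    ∃ c : NonAdaptiveLDC r d n,
      expLenN c ≤
        30 * (r * d + 1 : ℝ) *
          (((r : ℝ) + 1) ^ (r + 1) * (n.choose r : ℝ)) ^ (1 / (r * d + 1 : ℝ)) := by
  set y : ℝ := (((r : ℝ) + 1) ^ (r + 1) * (n.choose r : ℝ)) ^ (1 / (r * d + 1 : ℝ)) with hy
  have hpc := pow_le_choose' n r hr (by omega)
  have hn1 : (1 : ℝ) ≤ (n : ℝ) ^ r := one_le_pow₀ (by exact_mod_cast (by omega : 1 ≤ n))
  have hB1 : 1 ≤ ((r : ℝ) + 1) ^ (r + 1) * (n.choose r : ℝ) := hn1.trans hpc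
  have hy1 : 1 ≤ y := Real.one_le_rpow hB1 (by positivity)
  have hyp : y ^ (r * d + 1) = ((r : ℝ) + 1) ^ (r + 1) * (n.choose r : ℝ) := by
    rw [hy, one_div]
    have := Real.rpow_inv_natCast_pow (n := r * d + 1) (zero_le_one.trans hB1) (by omega)
    push_cast at this
    exact this
  have hyt : y ≤ (⌈y⌉₊ : ℝ) := Nat.le_ceil y
  have ht2 : (⌈y⌉₊ : ℝ) ≤ 2 * y := by
    have := Nat.ceil_lt_add_one (zero_le_one.trans hy1)
    linarith
  have ht1 : 1 ≤ ⌈y⌉₊ := by exact_mod_cast hy1.trans hyt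
  obtain ⟨c, hc⟩ := bound_t r d n ⌈y⌉₊ hr ht1 hrn
  refine ⟨c, hc.trans ?_⟩
  have hmax : max (1 : ℝ) ((n : ℝ) ^ r / (((⌈y⌉₊ : ℝ)) ^ d) ^ r) ≤ y := by
    apply max_le hy1
    rw [div_le_iff₀ (by positivity)]
    calc (n : ℝ) ^ r ≤ y ^ (r * d + 1) := by rw [hyp]; exact hpc
      _ = y * (y ^ d) ^ r := by rw [← pow_mul, pow_succ, mul_comm d r]; ring
      _ ≤ _ := by gcongr
  have hrd : (0 : ℝ) ≤ r * d := by positivity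
  have : (d : ℝ) * (r * (⌈y⌉₊ : ℝ)) ≤ r * d * (2 * y) := by
    calc _ = (r * d : ℝ) * (⌈y⌉₊ : ℝ) := by ring
      _ ≤ _ := mul_le_mul_of_nonneg_left ht2 hrd
  nlinarith [mul_nonneg hrd (zero_le_one.trans hy1)]
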